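/- arXiv:1612.07063 — 2 statements merged into one kernel-verified Lean document; each statement's English description precedes it below -/
import Mathlib

section
/- Let M be a trans-S-manifold with characteristic functions α_i, β_i and fundamental 2-form F. Then: (i) dF = 2 F ∧ Σ_{i=1}^s β_i η_i; (ii) dη_i = α_i F for every i = 1, …, s; (iii) f^*(δF) = 0, i.e. (δF)(fX) = 0 for every vector field X. -/
open scoped BigOperators

noncomputable section

/-- An abstract model of the algebra of smooth real-valued functions `C` of a
manifold together with its Lie algebra `V` of smooth vector fields: each vector
field acts on functions as a derivation, compatibly with the module structure
and the Lie bracket. -/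
structure DiffModel (C V : Type) [CommRing C] [Algebra ℝ C]
    [LieRing V] [Module C V] where
  act : V → C → C
  act_add_left : ∀ (X Y : V) (a : C), act (X + Y) a = act X a + act Y a
  act_smul_left : ∀ (c : C) (X : V) (a : C), act (c • X) a = c * act X a
  act_add : ∀ (X : V) (a b : C), act X (a + b) = act X a + act X b
  act_mul : ∀ (X : V) (a b : C), act X (a * b) = act X a * b + a * act X b
  act_const : ∀ (X : V) (r : ℝ), act X ((algebraMap ℝ C) r) = 0
  act_bracket : ∀ (X Y : V) (a : C),
    act ⁅X, Y⁆ a = act X (act Y a) - act Y (act X a)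
  bracket_smul_right : ∀ (X : V) (c : C) (Y : V),
    ⁅X, c • Y⁆ = act X c • Y + c • ⁅X, Y⁆

/-- A Riemannian metric together with its Levi-Civita connection on the
abstract model `D` of the vector fields of a manifold. -/
structure RiemStr {C V : Type} [CommRing C] [Algebra ℝ C]
    [LieRing V] [Module C V] (D : DiffModel C V) where
  g : V → V → C
  conn : V → V → V
  g_symm : ∀ X Y, g X Y = g Y X
  g_add_left : ∀ X Y Z, g (X + Y) Z = g X Z + g Y Z
  g_smul_left : ∀ (c : C) (X Y : V), g (c • X) Y = c * g X Y
  conn_add_left : ∀ X Y Z, conn (X + Y) Z = conn X Z + conn Y Z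
  conn_smul_left : ∀ (c : C) (X Y : V), conn (c • X) Y = c • conn X Y
  conn_add_right : ∀ X Y Z, conn X (Y + Z) = conn X Y + conn X Z
  conn_smul_right : ∀ (X : V) (c : C) (Y : V),
    conn X (c • Y) = D.act X c • Y + c • conn X Y
  torsion_free : ∀ X Y, conn X Y - conn Y X = ⁅X, Y⁆
  metric_compat : ∀ X Y Z, D.act X (g Y Z) = g (conn X Y) Z + g Y (conn X Z)

/-- An `f`-structure with `s` structure vector fields `ξ i` and dual `1`-forms
`η i` on the abstract model of the vector fields of a manifold:
`f` is a `(1,1)`-tensor field with `f ∘ f ∘ f + f = 0`, `f (ξ i) = 0`,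
`η i ∘ f = 0`, `η i (ξ j) = δ i j` and `f² = -id + Σ η i ⊗ ξ i`. -/
structure FStr (C V : Type) [CommRing C] [Algebra ℝ C]
    [LieRing V] [Module C V] (s : ℕ) where
  f : V → V
  ξ : Fin s → V
  η : Fin s → V → C
  f_add : ∀ X Y, f (X + Y) = f X + f Y
  f_smul : ∀ (c : C) (X : V), f (c • X) = c • f X
  η_add : ∀ i X Y, η i (X + Y) = η i X + η i Y
  η_smul : ∀ i (c : C) (X : V), η i (c • X) = c * η i X
  f_cube : ∀ X, f (f (f X)) + f X = 0
  f_ξ : ∀ i, f (ξ i) = 0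
  η_f : ∀ i X, η i (f X) = 0
  η_ξ : ∀ i j, η i (ξ j) = if i = j then (1 : C) else 0
  f_sq : ∀ X, f (f X) = -X + ∑ i, η i X • ξ i

section Defs

variable {C V : Type} [CommRing C] [Algebra ℝ C] [LieRing V] [Module C V] {s : ℕ}

/-- The compatibility of the metric with the `f`-structure:
`g(X,Y) = g(fX,fY) + Σ η i (X) η i (Y)`.  A metric `f`-manifold is the data of
`D`, `R`, `S` satisfying `MetricCompat D R S`. -/
def MetricCompat (D : DiffModel C V) (R : RiemStr D) (S : FStr C V s) : Prop :=
  ∀ X Y, R.g X Y = R.g (S.f X) (S.f Y) + ∑ i, S.η i X * S.η i Y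

/-- The covariant derivative `(∇_X f) Y` of the tensor field `f`. -/
def nablaF (D : DiffModel C V) (R : RiemStr D) (S : FStr C V s) (X Y : V) : V :=
  R.conn X (S.f Y) - S.f (R.conn X Y)

/-- The Nijenhuis tensor `[f,f]` of `f`. -/
def nijenhuis (S : FStr C V s) (X Y : V) : V :=
  S.f (S.f ⁅X, Y⁆) + ⁅S.f X, S.f Y⁆ - S.f ⁅S.f X, Y⁆ - S.f ⁅X, S.f Y⁆

/-- The exterior differential of a `1`-form,
`dθ(X,Y) = ½ (X θ(Y) - Y θ(X) - θ([X,Y]))`. -/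
def dOne (D : DiffModel C V) (θ : V → C) (X Y : V) : C :=
  algebraMap ℝ C (1 / 2) * (D.act X (θ Y) - D.act Y (θ X) - θ ⁅X, Y⁆)

/-- The exterior differential of a `2`-form. -/
def dTwo (D : DiffModel C V) (ω : V → V → C) (X Y Z : V) : C :=
  D.act X (ω Y Z) - D.act Y (ω X Z) + D.act Z (ω X Y)
    - ω ⁅X, Y⁆ Z + ω ⁅X, Z⁆ Y - ω ⁅Y, Z⁆ X

/-- The fundamental `2`-form `F(X,Y) = g(X, fY)` of a metric `f`-manifold. -/
def Fform (D : DiffModel C V) (R : RiemStr D) (S : FStr C V s) (X Y : V) : C :=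
  R.g X (S.f Y)

/-- Normality of an `f`-structure: `[f,f] + 2 Σ dη i ⊗ ξ i = 0`. -/
def IsNormal (D : DiffModel C V) (S : FStr C V s) : Prop :=
  ∀ X Y, nijenhuis S X Y + (2 : C) • ∑ i, dOne D (S.η i) X Y • S.ξ i = 0

/-- The almost trans-`S` condition with characteristic functions `α i`, `β i`:
`(∇_X f)Y = Σ [α i {g(fX,fY) ξ i + η i (Y) f²X} + β i {g(fX,Y) ξ i − η i (Y) fX}]`. -/
def IsAlmostTransS (D : DiffModel C V) (R : RiemStr D) (S : FStr C V s)
    (α β : Fin s → C) : Prop :=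
  ∀ X Y, nablaF D R S X Y =
    ∑ i, (α i • (R.g (S.f X) (S.f Y) • S.ξ i + S.η i Y • S.f (S.f X))
        + β i • (R.g (S.f X) Y • S.ξ i - S.η i Y • S.f X))

/-- A trans-`S`-manifold is a normal almost trans-`S`-manifold. -/
def IsTransS (D : DiffModel C V) (R : RiemStr D) (S : FStr C V s)
    (α β : Fin s → C) : Prop :=
  IsAlmostTransS D R S α β ∧ IsNormal D S

/-- A `K`-manifold: normal with closed fundamental `2`-form. -/
def IsK (D : DiffModel C V) (R : RiemStr D) (S : FStr C V s) : Prop :=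
  IsNormal D S ∧ ∀ X Y Z, dTwo D (Fform D R S) X Y Z = 0

/-- An `S`-manifold: a `K`-manifold with `F = dη i` for every `i`. -/
def IsSman (D : DiffModel C V) (R : RiemStr D) (S : FStr C V s) : Prop :=
  IsK D R S ∧ ∀ i X Y, Fform D R S X Y = dOne D (S.η i) X Y

/-- A `C`-manifold: a `K`-manifold with `dη i = 0` for every `i`. -/
def IsCman (D : DiffModel C V) (R : RiemStr D) (S : FStr C V s) : Prop :=
  IsK D R S ∧ ∀ (i : Fin s) X Y, dOne D (S.η i) X Y = 0

/-- The covariant derivative `(∇_X ω)(Y,Z)` of a `2`-form. -/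
def covTwo (D : DiffModel C V) (R : RiemStr D) (ω : V → V → C) (X Y Z : V) : C :=
  D.act X (ω Y Z) - ω (R.conn X Y) Z - ω Y (R.conn X Z)

/-- The covariant derivative `(∇_X θ)(Y)` of a `1`-form. -/
def covOne (D : DiffModel C V) (R : RiemStr D) (θ : V → C) (X Y : V) : C :=
  D.act X (θ Y) - θ (R.conn X Y)

/-- A global `f`-basis `{X_1,…,X_n, fX_1,…,fX_n, ξ_1,…,ξ_s}` of a
`(2n+s)`-dimensional metric `f`-manifold. -/
structure FBasis (D : DiffModel C V) (R : RiemStr D) (S : FStr C V s)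
    (n : ℕ) where
  e : Fin n → V
  orth : ∀ k l, R.g (e k) (e l) = if k = l then (1 : C) else 0
  orth_f : ∀ k l, R.g (e k) (S.f (e l)) = 0
  horiz : ∀ i k, S.η i (e k) = 0
  span : ∀ X : V, X = ∑ k, R.g X (e k) • e k
      + ∑ k, R.g X (S.f (e k)) • S.f (e k) + ∑ i, S.η i X • S.ξ i

/-- The codifferential `δω` of a `2`-form, computed in an `f`-basis:
`(δω)(X) = -Σ_k [(∇_{X_k}ω)(X_k,X) + (∇_{fX_k}ω)(fX_k,X)] - Σ_j (∇_{ξ_j}ω)(ξ_j,X)`. -/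
def codiffTwo {n : ℕ} (D : DiffModel C V) (R : RiemStr D) (S : FStr C V s)
    (B : FBasis D R S n) (ω : V → V → C) (X : V) : C :=
  -(∑ k, (covTwo D R ω (B.e k) (B.e k) X
      + covTwo D R ω (S.f (B.e k)) (S.f (B.e k)) X))
    - ∑ j, covTwo D R ω (S.ξ j) (S.ξ j) X

/-- The codifferential `δθ` of a `1`-form, computed in an `f`-basis. -/
def codiffOne {n : ℕ} (D : DiffModel C V) (R : RiemStr D) (S : FStr C V s)
    (B : FBasis D R S n) (θ : V → C) : C :=
  -(∑ k, (covOne D R θ (B.e k) (B.e k)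
      + covOne D R θ (S.f (B.e k)) (S.f (B.e k))))
    - ∑ j, covOne D R θ (S.ξ j) (S.ξ j)

/-- The Lie derivative of the metric along `ξ`:
`(L_ξ g)(X,Y) = ξ g(X,Y) - g([ξ,X],Y) - g(X,[ξ,Y])`. -/
def lieDerivG (D : DiffModel C V) (R : RiemStr D) (ξ X Y : V) : C :=
  D.act ξ (R.g X Y) - R.g ⁅ξ, X⁆ Y - R.g X ⁅ξ, Y⁆

end Defs

section Helpers

variable {C V : Type} [CommRing C] [Algebra ℝ C] [LieRing V] [Module C V] {s : ℕ}

/-- `g Y` as a linear map. -/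
def gLin {D : DiffModel C V} (R : RiemStr D) (Y : V) : V →ₗ[C] C where
  toFun Z := R.g Y Z
  map_add' a b := by rw [R.g_symm, R.g_add_left, R.g_symm a, R.g_symm b]
  map_smul' c a := by rw [R.g_symm, R.g_smul_left, R.g_symm a]; rfl

/-- `f` as a linear map. -/
def fLin (S : FStr C V s) : V →ₗ[C] V where
  toFun := S.f
  map_add' := S.f_add
  map_smul' := S.f_smul

/-- `η i` as a linear map. -/
def etaLin (S : FStr C V s) (i : Fin s) : V →ₗ[C] C where
  toFun := S.η i
  map_add' := S.η_add i
  map_smul' := S.η_smul i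

theorem gLin_apply {D : DiffModel C V} (R : RiemStr D) (Y Z : V) : R.g Y Z = gLin R Y Z := rfl
theorem fLin_apply (S : FStr C V s) (Y : V) : S.f Y = fLin S Y := rfl
theorem etaLin_apply (S : FStr C V s) (i : Fin s) (Y : V) : S.η i Y = etaLin S i Y := rfl

variable {D : DiffModel C V} {R : RiemStr D} {S : FStr C V s}

theorem g_xi (hc : MetricCompat D R S) (i : Fin s) (Y : V) : R.g Y (S.ξ i) = S.η i Y := by
  have h0 : R.g (S.f Y) 0 = 0 := (gLin R _).map_zero
  rw [hc, S.f_ξ, h0]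
  simp [S.η_ξ]

theorem g_f_skew (hc : MetricCompat D R S) (X Y : V) : R.g (S.f X) Y = - R.g X (S.f Y) := by
  rw [hc (S.f X) Y, S.f_sq, R.g_symm, gLin_apply]
  simp only [map_add, map_neg, map_sum, map_smul, ← gLin_apply, g_xi hc, S.η_f]
  simp [R.g_symm]

theorem g_add_r (X Y Z : V) : R.g X (Y + Z) = R.g X Y + R.g X Z := (gLin R X).map_add Y Z
theorem g_sub_r (X Y Z : V) : R.g X (Y - Z) = R.g X Y - R.g X Z := (gLin R X).map_sub Y Z
theorem g_sub_l (X Y Z : V) : R.g (X - Y) Z = R.g X Z - R.g Y Z := by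
  rw [R.g_symm, g_sub_r, R.g_symm Z, R.g_symm Z]

theorem cov_F (hc : MetricCompat D R S) {α β : Fin s → C} (h : IsAlmostTransS D R S α β)
    (X Y Z : V) : covTwo D R (Fform D R S) X Y Z =
      R.g (S.f X) (S.f Z) * (∑ i, α i * S.η i Y) - R.g (S.f X) (S.f Y) * (∑ i, α i * S.η i Z)
      + R.g Z (S.f X) * (∑ i, β i * S.η i Y) - R.g Y (S.f X) * (∑ i, β i * S.η i Z) := by
  have h1 : covTwo D R (Fform D R S) X Y Z = R.g Y (nablaF D R S X Z) := by
    unfold covTwo Fform nablaF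
    rw [R.metric_compat, g_sub_r]; ring
  have h2 : R.g Y (S.f (S.f X)) = - R.g (S.f X) (S.f Y) := by
    rw [← neg_eq_iff_eq_neg, ← g_f_skew hc, R.g_symm]
  rw [h1, h X Z, gLin_apply]
  simp only [map_add, map_sub, map_sum, map_smul, ← gLin_apply, g_xi hc, h2, smul_eq_mul,
    Finset.mul_sum]
  rw [← Finset.sum_sub_distrib, ← Finset.sum_add_distrib, ← Finset.sum_sub_distrib]
  refine Finset.sum_congr rfl fun i _ => ?_
  rw [R.g_symm Z (S.f X)]; ring

theorem dTwo_eq_cov (hc : MetricCompat D R S) (X Y Z : V) :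
    dTwo D (Fform D R S) X Y Z = covTwo D R (Fform D R S) X Y Z
      + covTwo D R (Fform D R S) Y Z X + covTwo D R (Fform D R S) Z X Y := by
  have sk : ∀ A B, R.g A (S.f B) = - R.g B (S.f A) := fun A B => by
    rw [← g_f_skew hc, R.g_symm]
  have act_neg : ∀ (A : V) (a : C), D.act A (-a) = - D.act A a := fun A a => by
    have h0 := D.act_add A 0 0
    have h1 := D.act_add A a (-a)
    rw [add_zero] at h0
    rw [add_neg_cancel] at h1
    linear_combination -h1 - h0
  unfold dTwo covTwo Fform
  rw [← R.torsion_free, ← R.torsion_free, ← R.torsion_free]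
  simp only [g_sub_l]
  rw [sk X Z, act_neg, sk Y (R.conn X Z), sk Z (R.conn Y X), sk X (R.conn Z Y)]
  ring

theorem two_half : (2 : C) * algebraMap ℝ C (1 / 2) = 1 := by
  rw [← map_ofNat (algebraMap ℝ C) 2, ← map_mul]; norm_num

theorem dOne_two (hc : MetricCompat D R S) (i : Fin s) (X Y : V) :
    2 * dOne D (S.η i) X Y = R.g Y (R.conn X (S.ξ i)) - R.g X (R.conn Y (S.ξ i)) := by
  unfold dOne
  rw [← mul_assoc, two_half, one_mul, ← R.torsion_free]
  simp only [← g_xi hc]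
  rw [R.metric_compat, R.metric_compat, g_sub_l]; ring

theorem dOne_eta (hc : MetricCompat D R S) {α β : Fin s → C} (h : IsAlmostTransS D R S α β)
    (j : Fin s) (X Y : V) : 2 * dOne D (S.η j) (S.f X) (S.f Y)
      = 2 * (α j * R.g (S.f X) (S.f (S.f Y))) := by
  have key : ∀ A B : V, R.g (S.f A) (R.conn B (S.ξ j))
      = α j * R.g A (S.f (S.f B)) - β j * R.g A (S.f B) := fun A B => by
    have h1 := h B (S.ξ j)
    have z : R.conn B (0 : V) = 0 := by
      have := R.conn_add_right B 0 0
      rw [add_zero] at this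
      simpa using this
    have g0 : R.g (S.f B) 0 = 0 := (gLin R _).map_zero
    unfold nablaF at h1
    simp only [S.f_ξ, z, g0, g_xi hc, S.η_f, S.η_ξ] at h1
    have h2 := congrArg (gLin R A) h1
    simp only [zero_smul, zero_add, zero_sub, ite_smul, one_smul, smul_ite, smul_zero,
      Finset.sum_add_distrib, smul_neg, Finset.sum_neg_distrib,
      Finset.sum_ite_eq', Finset.mem_univ, if_true, map_add, map_neg, map_smul,
      ← gLin_apply, smul_eq_mul] at h2
    rw [g_f_skew hc, h2]; ring
  have sk : ∀ A B, R.g A (S.f B) = - R.g B (S.f A) := fun A B => by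
    rw [← g_f_skew hc, R.g_symm]
  rw [dOne_two hc, key, key]
  have e1 : R.g Y (S.f (S.f (S.f X))) = R.g (S.f X) (S.f (S.f Y)) := by
    rw [sk, g_f_skew hc, neg_neg, sk, g_f_skew hc, neg_neg, R.g_symm, hc]
  have e2 : R.g X (S.f (S.f (S.f Y))) = - R.g (S.f X) (S.f (S.f Y)) := by
    rw [g_f_skew hc, neg_neg]
  have e3 : R.g Y (S.f (S.f X)) = R.g X (S.f (S.f Y)) := by
    rw [sk, g_f_skew hc, neg_neg, sk, g_f_skew hc, neg_neg, R.g_symm]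
  rw [e1, e2, e3]; ring

theorem eta_xi (hn : IsNormal D S) (k l : Fin s) (Y : V) : 2 * dOne D (S.η k) (S.ξ l) Y = 0 := by
  have h1 := congrArg (etaLin S k) (hn (S.ξ l) Y)
  unfold nijenhuis at h1
  rw [S.f_ξ, zero_lie, zero_lie] at h1
  simp only [map_add, map_sub, map_sum, map_smul, ← etaLin_apply, S.η_f, S.η_ξ, map_zero,
    smul_eq_mul] at h1
  simpa using h1

theorem cancel_two {a b : C} (h : 2 * a = 2 * b) : a = b := by
  have := congrArg (fun x => algebraMap ℝ C (1 / 2) * x) h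
  simp only [← mul_assoc] at this
  rwa [mul_comm _ (2 : C), two_half, one_mul, one_mul] at this

theorem dOne_xi_hor (hc : MetricCompat D R S) (hn : IsNormal D S) (k : Fin s) (X Y : V) :
    2 * dOne D (S.η k) (S.f (S.f X)) Y = - (2 * dOne D (S.η k) X Y) := by
  have cs : ∀ (t : Finset (Fin s)) (c : Fin s → C) (W : V),
      R.conn (∑ i ∈ t, c i • S.ξ i) W = ∑ i ∈ t, c i • R.conn (S.ξ i) W := by
    intro t c W
    let L : V →ₗ[C] V := ⟨⟨fun X => R.conn X W, fun a b => R.conn_add_left a b W⟩,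
      fun c a => R.conn_smul_left c a W⟩
    have : L (∑ i ∈ t, c i • S.ξ i) = ∑ i ∈ t, c i • L (S.ξ i) := by
      simp only [map_sum, map_smul]
    exact this
  have cn : ∀ X W : V, R.conn (-X) W = - R.conn X W := fun X W => by
    have := R.conn_smul_left (-1) X W
    simpa using this
  have h0 : ∑ i, S.η i X * (2 * dOne D (S.η k) (S.ξ i) Y) = 0 := by
    simp only [eta_xi hn, mul_zero, Finset.sum_const_zero]
  simp only [dOne_two hc] at h0 ⊢
  rw [S.f_sq, R.conn_add_left, cs, cn, R.g_symm (-X + _), gLin_apply, gLin_apply]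
  simp only [map_add, map_neg, map_sum, map_smul, ← gLin_apply, smul_eq_mul]
  simp only [mul_sub, Finset.sum_sub_distrib] at h0
  simp only [R.g_symm (R.conn Y _)]
  linear_combination h0

theorem dOne_skew (hc : MetricCompat D R S) (k : Fin s) (X Y : V) :
    2 * dOne D (S.η k) X Y = - (2 * dOne D (S.η k) Y X) := by
  rw [dOne_two hc, dOne_two hc]; ring

theorem dOne_final (hc : MetricCompat D R S) {α β : Fin s → C} (hM : IsTransS D R S α β)
    (i : Fin s) (X Y : V) : dOne D (S.η i) X Y = α i * Fform D R S X Y := by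
  apply cancel_two
  have e : 2 * dOne D (S.η i) X Y = 2 * dOne D (S.η i) (S.f (S.f X)) (S.f (S.f Y)) := by
    rw [dOne_xi_hor hc hM.2, dOne_skew hc i X (S.f (S.f Y)), dOne_xi_hor hc hM.2,
      dOne_skew hc i Y X]
    ring
  have c3 : ∀ Z, S.f (S.f (S.f Z)) = - S.f Z := fun Z => eq_neg_of_add_eq_zero_left (S.f_cube Z)
  have gn : ∀ A B, R.g A (-B) = - R.g A B := fun A B => (gLin R A).map_neg B
  rw [e, dOne_eta hc hM.1, g_f_skew hc, c3, gn, neg_neg, g_f_skew hc, c3, gn, neg_neg]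
  rfl

end Helpers

/-- In a trans-`S`-manifold:
(i) `dF = 2 F ∧ Σ_i β_i η_i`; (ii) `dη_i = α_i F`; (iii) `f^*(δF) = 0`,
i.e. `(δF)(fX) = 0` for every `X`. -/
theorem transS_dF_deta_fdeltaF
    {C V : Type} [CommRing C] [Algebra ℝ C] [LieRing V] [Module C V]
    {s n : ℕ} (D : DiffModel C V) (R : RiemStr D) (S : FStr C V s)
    (hcompat : MetricCompat D R S) (B : FBasis D R S n) (α β : Fin s → C)
    (hM : IsTransS D R S α β) :
    (∀ X Y Z : V,
      dTwo D (Fform D R S) X Y Z =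
        2 * (Fform D R S X Y * (∑ i, β i * S.η i Z)
          + Fform D R S Y Z * (∑ i, β i * S.η i X)
          + Fform D R S Z X * (∑ i, β i * S.η i Y))) ∧
    (∀ (i : Fin s) (X Y : V),
      dOne D (S.η i) X Y = α i * Fform D R S X Y) ∧
    (∀ X : V, codiffTwo D R S B (Fform D R S) (S.f X) = 0) := by
  refine ⟨fun X Y Z => ?_, fun i X Y => dOne_final hcompat hM i X Y, fun X => ?_⟩
  · have sk : ∀ A B, R.g A (S.f B) = - R.g B (S.f A) := fun A B => by
      rw [← g_f_skew hcompat, R.g_symm]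
    rw [dTwo_eq_cov hcompat, cov_F hcompat hM.1, cov_F hcompat hM.1, cov_F hcompat hM.1]
    unfold Fform
    rw [R.g_symm (S.f Y) (S.f X), R.g_symm (S.f Z) (S.f X), R.g_symm (S.f Z) (S.f Y),
      sk Y X, sk X Z, sk Z Y]
    ring
  · have g0 : ∀ A, R.g A 0 = 0 := fun A => (gLin R A).map_zero
    have g0' : ∀ A, R.g 0 A = 0 := fun A => by rw [R.g_symm, g0]
    unfold codiffTwo
    simp only [cov_F hcompat hM.1, B.horiz, S.η_f, S.f_ξ, g0, g0']
    simp
end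
end

section
/- A trans-S-manifold M is a K-manifold if and only if δη_i = 0 for every i = 1, …, s, where δ is the codifferential. -/
open scoped BigOperators

noncomputable section

section Helpers

variable {C V : Type} [CommRing C] [Algebra ℝ C] [LieRing V] [Module C V] {s n : ℕ}
  {D : DiffModel C V} {R : RiemStr D} {S : FStr C V s}

theorem h_add_right (R : RiemStr D) (X Y Z : V) : R.g X (Y + Z) = R.g X Y + R.g X Z := by
  rw [R.g_symm, R.g_add_left, R.g_symm Y, R.g_symm Z]

theorem h_smul_right (R : RiemStr D) (c : C) (X Y : V) : R.g X (c • Y) = c * R.g X Y := by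
  rw [R.g_symm, R.g_smul_left, R.g_symm Y]

theorem h_zero_right (R : RiemStr D) (X : V) : R.g X 0 = 0 := by
  have := h_smul_right R 0 X 0
  simpa using this

theorem h_neg_right (R : RiemStr D) (X Y : V) : R.g X (-Y) = - R.g X Y := by
  have := h_smul_right R (-1) X Y
  simpa using this

theorem h_sub_right (R : RiemStr D) (X Y Z : V) : R.g X (Y - Z) = R.g X Y - R.g X Z := by
  rw [sub_eq_add_neg, h_add_right, h_neg_right, sub_eq_add_neg]

theorem h_sub_left (R : RiemStr D) (X Y Z : V) : R.g (X - Y) Z = R.g X Z - R.g Y Z := by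
  rw [R.g_symm, h_sub_right, R.g_symm X, R.g_symm Y]

theorem h_sum_right (R : RiemStr D) {ι : Type} (t : Finset ι) (X : V) (Y : ι → V) :
    R.g X (∑ i ∈ t, Y i) = ∑ i ∈ t, R.g X (Y i) := by
  classical
  induction t using Finset.induction_on with
  | empty => simp [h_zero_right]
  | insert a t ha ih => rw [Finset.sum_insert ha, Finset.sum_insert ha, h_add_right, ih]

theorem h_f_zero (S : FStr C V s) : S.f 0 = 0 := by
  have := S.f_smul 0 0
  simpa using this

theorem h_xi (hc : MetricCompat D R S) (X : V) (i : Fin s) : R.g X (S.ξ i) = S.η i X := by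
  rw [hc, S.f_ξ, h_zero_right]
  simp [S.η_ξ]

theorem h_ff (hc : MetricCompat D R S) (X Y : V) :
    R.g X (S.f (S.f Y)) = - R.g (S.f X) (S.f Y) := by
  rw [S.f_sq, h_add_right, h_neg_right, h_sum_right, hc X Y]
  have : ∑ i, R.g X (S.η i Y • S.ξ i) = ∑ i, S.η i X * S.η i Y :=
    Finset.sum_congr rfl fun i _ => by rw [h_smul_right, h_xi hc, mul_comm]
  rw [this]; ring

theorem h_skew (hc : MetricCompat D R S) (X Y : V) :
    R.g X (S.f Y) = - R.g (S.f X) Y := by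
  rw [hc X (S.f Y), R.g_symm, S.f_sq Y, R.g_symm, h_add_right, h_neg_right, h_sum_right]
  simp [h_smul_right, h_xi hc, S.η_f]

theorem h_nabla (hc : MetricCompat D R S) {α β : Fin s → C} (h : IsAlmostTransS D R S α β)
    (W X Y : V) : R.g W (nablaF D R S X Y) =
      ∑ i, (α i * (R.g (S.f X) (S.f Y) * S.η i W - S.η i Y * R.g (S.f W) (S.f X))
        + β i * (R.g (S.f X) Y * S.η i W - S.η i Y * R.g W (S.f X))) := by
  rw [h, h_sum_right]
  refine Finset.sum_congr rfl fun i _ => ?_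
  simp only [h_add_right, h_sub_right, h_smul_right, h_xi hc, h_ff hc]
  ring

theorem h_dF (hc : MetricCompat D R S) (X Y Z : V) :
    dTwo D (Fform D R S) X Y Z = R.g Y (nablaF D R S X Z) - R.g X (nablaF D R S Y Z)
      + R.g X (nablaF D R S Z Y) := by
  simp only [dTwo, Fform, nablaF, R.metric_compat, ← R.torsion_free, h_sub_left, h_sub_right]
  have e : ∀ A B, R.g A (S.f B) = - R.g B (S.f A) := fun A B => by
    rw [h_skew hc, R.g_symm]
  rw [e Y (R.conn X Z), e X (R.conn Y Z), e X (R.conn Z Y)]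
  ring

theorem h_dF' (hc : MetricCompat D R S) {α β : Fin s → C} (h : IsAlmostTransS D R S α β)
    (X Y Z : V) : dTwo D (Fform D R S) X Y Z =
      ∑ i, 2 * (β i * (R.g (S.f X) Z * S.η i Y - R.g (S.f X) Y * S.η i Z
        - R.g (S.f Y) Z * S.η i X)) := by
  rw [h_dF hc, h_nabla hc h, h_nabla hc h, h_nabla hc h, ← Finset.sum_sub_distrib,
    ← Finset.sum_add_distrib]
  refine Finset.sum_congr rfl fun i _ => ?_
  have e : ∀ A B, R.g A (S.f B) = R.g (S.f B) A := fun A B => R.g_symm _ _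
  have e2 : ∀ A B, R.g (S.f A) B = - R.g (S.f B) A := fun A B => by
    rw [R.g_symm, h_skew hc]
  rw [R.g_symm (S.f Z) (S.f Y), R.g_symm (S.f Y) (S.f X), e Y X, e X Y, e X Z,
    e2 Z Y, e2 Z X, e2 Y X]
  ring

theorem h_fnxi (hc : MetricCompat D R S) {α β : Fin s → C} (h : IsAlmostTransS D R S α β)
    (X : V) (j : Fin s) :
    S.f (R.conn X (S.ξ j)) = -(α j • S.f (S.f X) - β j • S.f X) := by
  have h1 := h X (S.ξ j)
  have c0 : R.conn X 0 = 0 := by simpa using R.conn_add_right X 0 0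
  simp only [nablaF, S.f_ξ, c0, h_zero_right, h_xi hc, S.η_f, S.η_ξ] at h1
  rw [← neg_eq_iff_eq_neg, ← zero_sub, h1]
  rw [Finset.sum_eq_single j]
  · simp [sub_eq_add_neg]
  · intro b _ hb; simp [hb]
  · simp

theorem h_cov (hc : MetricCompat D R S) (i : Fin s) (X Y : V) :
    covOne D R (S.η i) X Y = R.g Y (R.conn X (S.ξ i)) := by
  simp only [covOne, ← h_xi hc, R.metric_compat]
  ring

theorem h_actone (D : DiffModel C V) (X : V) : D.act X 1 = 0 := by
  simpa using D.act_const X 1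

theorem h_actzero (D : DiffModel C V) (X : V) : D.act X 0 = 0 := by
  simpa using D.act_const X 0

theorem h_two {a : C} {m : ℕ} (hm : m ≠ 0) (h : (m : C) * a = 0) : a = 0 := by
  have : (algebraMap ℝ C (m : ℝ)⁻¹) * (algebraMap ℝ C (m : ℝ)) = 1 := by
    rw [← map_mul, inv_mul_cancel₀ (by exact_mod_cast hm), map_one]
  rw [map_natCast] at this
  calc a = (algebraMap ℝ C (m : ℝ)⁻¹ * m) * a := by rw [this, one_mul]
    _ = 0 := by rw [mul_assoc, h, mul_zero]

theorem h_eta_zero (S : FStr C V s) (i : Fin s) : S.η i 0 = 0 := by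
  simpa using S.η_smul i 0 0

theorem h_bracket (hc : MetricCompat D R S) (hN : IsNormal D S) (i j k : Fin s) :
    S.η k ⁅S.ξ i, S.ξ j⁆ = 0 := by
  have h1 := hN (S.ξ i) (S.ξ j)
  have h2 := congrArg (fun v => R.g v (S.ξ k)) h1
  simp only [nijenhuis, S.f_ξ, zero_lie, lie_zero, h_f_zero, sub_zero, add_zero] at h2
  rw [R.g_symm, R.g_symm 0, h_zero_right, h_add_right, h_smul_right, h_sum_right] at h2
  rw [R.g_symm, h_xi hc, S.η_f] at h2
  simp only [h_smul_right, h_xi hc, S.η_ξ] at h2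
  simp only [mul_ite, mul_one, mul_zero, Finset.sum_ite_eq', Finset.sum_ite_eq, Finset.mem_univ,
    if_true, zero_add] at h2
  have h3 := h_two (m := 2) (by norm_num) (by exact_mod_cast h2)
  have a1 : ∀ X (p : Prop) [Decidable p], D.act X (if p then 1 else 0) = 0 := by
    intro X p _; split_ifs <;> simp [h_actone, h_actzero]
  simp only [dOne, S.η_ξ, a1] at h3
  have h4 : algebraMap ℝ C 2 * algebraMap ℝ C (1/2) = 1 := by
    rw [← map_mul]; norm_num
  linear_combination (- algebraMap ℝ C 2) * h3 - S.η k ⁅S.ξ i, S.ξ j⁆ * h4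

theorem h_xixi (hc : MetricCompat D R S) (hN : IsNormal D S) (i j : Fin s) :
    covOne D R (S.η i) (S.ξ j) (S.ξ j) = 0 := by
  rw [h_cov hc]
  have h1 := h_bracket hc hN j i j
  rw [← R.torsion_free, ← h_xi hc, h_sub_left] at h1
  have h2 := R.metric_compat (S.ξ i) (S.ξ j) (S.ξ j)
  rw [h_xi hc, S.η_ξ, if_pos rfl, h_actone, R.g_symm (S.ξ j), ← two_mul] at h2
  have h3 := h_two (m := 2) (by norm_num) (by exact_mod_cast h2.symm)
  rw [R.g_symm]
  linear_combination h1 + h3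

theorem h_codiff (hc : MetricCompat D R S) {α β : Fin s → C} (hM : IsTransS D R S α β)
    (B : FBasis D R S n) (i : Fin s) :
    codiffOne D R S B (S.η i) = -(((2 * n : ℕ) : C) * β i) := by
  have a1 : ∀ k, R.g (S.f (B.e k)) (S.f (B.e k)) = 1 := fun k => by
    have := hc (B.e k) (B.e k)
    simpa [B.orth, B.horiz] using this.symm
  have a2 : ∀ X, R.g (S.f X) (S.f (S.f X)) = R.g X (S.f X) := fun X => by
    have := hc X (S.f X)
    simpa [S.η_f] using this.symm
  have h1 : ∀ k, covOne D R (S.η i) (B.e k) (B.e k) = β i := fun k => by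
    rw [h_cov hc, hc, h_fnxi hc hM.1]
    simp [h_neg_right, h_sub_right, h_smul_right, B.horiz, a1, a2, B.orth_f]
  have h2 : ∀ k, covOne D R (S.η i) (S.f (B.e k)) (S.f (B.e k)) = β i := fun k => by
    rw [h_cov hc, hc, h_fnxi hc hM.1]
    have b1 : R.g (S.f (S.f (B.e k))) (S.f (S.f (B.e k))) = 1 := by
      have := hc (S.f (B.e k)) (S.f (B.e k))
      rw [a1] at this
      simpa [S.η_f] using this.symm
    simp [h_neg_right, h_sub_right, h_smul_right, S.η_f, b1, a2, B.orth_f]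
  simp only [codiffOne, h1, h2, h_xixi hc hM.2]
  simp
  ring

end Helpers

/-- A trans-`S`-manifold is a `K`-manifold if and only if
`δη_i = 0` for every `i`. -/
theorem transS_isK_iff_codiff_eta_zero
    {C V : Type} [CommRing C] [Algebra ℝ C] [LieRing V] [Module C V]
    {s n : ℕ} (D : DiffModel C V) (R : RiemStr D) (S : FStr C V s)
    (hcompat : MetricCompat D R S) (B : FBasis D R S n) (α β : Fin s → C)
    (hM : IsTransS D R S α β) :
    IsK D R S ↔ ∀ i : Fin s, codiffOne D R S B (S.η i) = 0 := by
  constructor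
  · intro hK i
    rw [h_codiff hcompat hM B i]
    rcases Nat.eq_zero_or_pos n with hn | hn
    · simp [hn]
    · have h1 := hK.2 (B.e ⟨0, hn⟩) (S.f (B.e ⟨0, hn⟩)) (S.ξ i)
      have a1 : R.g (S.f (B.e ⟨0, hn⟩)) (S.f (B.e ⟨0, hn⟩)) = 1 := by
        have := hcompat (B.e ⟨0, hn⟩) (B.e ⟨0, hn⟩)
        simpa [B.orth, B.horiz] using this.symm
      rw [h_dF' hcompat hM.1] at h1
      simp only [S.η_f, B.horiz, a1, S.η_ξ] at h1
      simp at h1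
      have h3 := h_two (m := 2) (by norm_num) (by exact_mod_cast h1)
      rw [h3]; simp
  · intro h
    refine ⟨hM.2, fun X Y Z => ?_⟩
    rcases Nat.eq_zero_or_pos n with hn | hn
    · subst hn
      have f0 : ∀ X, S.f X = 0 := fun X => by
        have h1 := S.f_sq X
        have h2 := B.span X
        simp only [Finset.univ_eq_empty, Finset.sum_empty, zero_add] at h2
        rw [← h2, neg_add_cancel] at h1
        have h3 := S.f_cube X
        rwa [h1, h_f_zero, zero_add] at h3
      simp [dTwo, Fform, f0, h_zero_right, h_actzero]
    · have hb : ∀ i, β i = 0 := fun i => by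
        have h1 := h i
        rw [h_codiff hcompat hM B i, neg_eq_zero] at h1
        exact h_two (by omega) h1
      rw [h_dF' hcompat hM.1]
      simp [hb]
end
end
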